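/- Assume ν > −1/2. There exists a constant C such that for every g ∈ L¹(0,1) (Lebesgue measure), ∫_0^1 sup_{t>1} |P_t g(x)| dx ≤ C ∫_0^1 |g(y)| dy; that is, the maximal operator M^∞ g(x) = sup_{t>1} |P_t g(x)| is bounded on L¹(0,1). -/

import Mathlib

open MeasureTheory Real Set Filter Topology
open scoped ENNReal NNReal

/-- Bessel function of the first kind of order `ν` (defined by its power series). -/
noncomputable def besselJ (ν x : ℝ) : ℝ :=
  ∑' m : ℕ, ((-1 : ℝ) ^ m / ((m.factorial : ℝ) * Real.Gamma ((m : ℝ) + ν + 1))) *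
    (x / 2) ^ (2 * (m : ℝ) + ν)

/-- `Λ` enumerates the successive positive zeros of `J_ν`, in increasing order,
`Λ n` corresponding to `λ_{n+1,ν}`. -/
def IsPositiveZerosOfBesselJ (ν : ℝ) (Λ : ℕ → ℝ) : Prop :=
  StrictMono Λ ∧ (∀ n, 0 < Λ n) ∧ (∀ n, besselJ ν (Λ n) = 0) ∧
    ∀ x : ℝ, 0 < x → besselJ ν x = 0 → ∃ n, Λ n = x

/-- The eigenfunctions `φ_n^ν`. -/
noncomputable def phiFB (ν : ℝ) (Λ : ℕ → ℝ) (n : ℕ) (x : ℝ) : ℝ :=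
  (Real.sqrt 2 / |Λ n * besselJ (ν + 1) (Λ n)|) * Real.sqrt (Λ n) *
    besselJ ν (Λ n * x) * x ^ (-ν)

/-- The Fourier–Bessel Poisson kernel `𝒫_t(x,y)`. -/
noncomputable def pKer (ν : ℝ) (Λ : ℕ → ℝ) (t x y : ℝ) : ℝ :=
  ∑' n : ℕ, Real.exp (-t * Λ n) * phiFB ν Λ n x * phiFB ν Λ n y

/-- The kernel `P_t(x,y) = (xy)^{ν+1/2} 𝒫_t(x,y)`. -/
noncomputable def pKerL (ν : ℝ) (Λ : ℕ → ℝ) (t x y : ℝ) : ℝ :=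
  (x * y) ^ (ν + 1/2) * pKer ν Λ t x y

/-- The measure `dμ(x) = x^{2ν+1} dx` on `(0,1)`. -/
noncomputable def muMeas (ν : ℝ) : Measure ℝ :=
  (volume.restrict (Ioo 0 1)).withDensity fun x => ENNReal.ofReal (x ^ (2 * ν + 1))

noncomputable def pI (j : ℕ) : ℝ := 1 - (1/2 : ℝ) ^ j
noncomputable def qI (j : ℕ) : ℝ := 1 - (1/2 : ℝ) ^ (j + 1)

/-- The `s`-dilate (same center, `s` times the length) of `(p,q]`, intersected with `(0,1)`. -/
def starSet (s p q : ℝ) : Set ℝ :=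
  Ioc ((p + q)/2 - s * (q - p)/2) ((p + q)/2 + s * (q - p)/2) ∩ Ioo 0 1

noncomputable def Istar (j : ℕ) : Set ℝ := starSet (51/50) (pI j) (qI j)
noncomputable def Istar2 (j : ℕ) : Set ℝ := starSet ((51/50)^2) (pI j) (qI j)

noncomputable def pJ (j : ℤ) : ℝ := if 1 ≤ j then 1 - (2:ℝ) ^ (-j) else (2:ℝ) ^ (j - 1)
noncomputable def qJ (j : ℤ) : ℝ := if 1 ≤ j then 1 - (2:ℝ) ^ (-j - 1) else (2:ℝ) ^ j

noncomputable def Jstar (j : ℤ) : Set ℝ := starSet (51/50) (pJ j) (qJ j)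
noncomputable def Jstar2 (j : ℤ) : Set ℝ := starSet ((51/50)^2) (pJ j) (qJ j)

/-- Modified Bessel function of the first kind. -/
noncomputable def besselI (ν x : ℝ) : ℝ :=
  ∑' m : ℕ, (1 / ((m.factorial : ℝ) * Real.Gamma ((m : ℝ) + ν + 1))) *
    (x / 2) ^ (2 * (m : ℝ) + ν)

/-- The Bessel heat kernel `𝐓_t(x,y)` on `(0,∞)`. -/
noncomputable def bHeatKer (ν t x y : ℝ) : ℝ :=
  (2*t)⁻¹ * Real.exp (-(x^2 + y^2)/(4*t)) * besselI ν (x*y/(2*t)) * (x*y) ^ (-ν)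

/-- The Fourier–Bessel heat kernel `𝒯_t(x,y)` on `(0,1)`. -/
noncomputable def fbHeatKer (ν : ℝ) (Λ : ℕ → ℝ) (t x y : ℝ) : ℝ :=
  ∑' n : ℕ, Real.exp (-t * (Λ n)^2) * phiFB ν Λ n x * phiFB ν Λ n y

/-- The entire function `G_μ` with `J_μ(x) = (x/2)^μ G_μ(x²/4)`. -/
noncomputable def besselEntire (μ w : ℝ) : ℝ :=
  ∑' m : ℕ, ((-1 : ℝ) ^ m / ((m.factorial : ℝ) * Real.Gamma ((m : ℝ) + μ + 1))) * w ^ m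

lemma half_Gamma_le_Gamma_nat_add {μ : ℝ} (hμ : -(1/2 : ℝ) < μ) (m : ℕ) :
    Real.Gamma (μ + 1) / 2 ≤ Real.Gamma ((m : ℝ) + μ + 1) := by
  have h0 : 0 < Real.Gamma (μ + 1) := Real.Gamma_pos_of_pos (by linarith)
  have hrec : ∀ m : ℕ, Real.Gamma (((m + 1 : ℕ) : ℝ) + μ + 1) =
      ((m : ℝ) + μ + 1) * Real.Gamma ((m : ℝ) + μ + 1) := by
    intro m
    have hm : (0 : ℝ) ≤ m := m.cast_nonneg
    rw [← Real.Gamma_add_one (by linarith)]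
    congr 1
    push_cast
    ring
  rcases m with _ | m
  · simp only [Nat.cast_zero, zero_add]
    linarith
  induction m with
  | zero =>
    rw [hrec 0]
    simp only [Nat.cast_zero, zero_add]
    nlinarith
  | succ k ih =>
    rw [hrec (k + 1)]
    have hk : (0 : ℝ) ≤ k := k.cast_nonneg
    refine ih.trans (le_mul_of_one_le_left ?_ ?_)
    · linarith
    · push_cast
      linarith

lemma abs_besselEntire_coeff_le {μ : ℝ} (hμ : -(1/2 : ℝ) < μ) (m : ℕ) :
    |(-1 : ℝ) ^ m / ((m.factorial : ℝ) * Real.Gamma ((m : ℝ) + μ + 1))| ≤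
      2 / Real.Gamma (μ + 1) * (1 / m.factorial) := by
  have h0 : 0 < Real.Gamma (μ + 1) := Real.Gamma_pos_of_pos (by linarith)
  have h1 := half_Gamma_le_Gamma_nat_add hμ m
  have hf : (0 : ℝ) < m.factorial := by exact_mod_cast m.factorial_pos
  rw [abs_div, abs_pow, abs_neg, abs_one, one_pow, abs_of_pos (mul_pos hf (by linarith))]
  calc 1 / ((m.factorial : ℝ) * Real.Gamma ((m : ℝ) + μ + 1))
      ≤ 1 / ((m.factorial : ℝ) * (Real.Gamma (μ + 1) / 2)) := by gcongr
    _ = _ := by field_simp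

/-- Term-by-term differentiation of a power series with factorially decaying coefficients. -/
lemma hasDerivAt_tsum_mul_pow {a : ℕ → ℝ} {K : ℝ} (ha : ∀ m, |a m| ≤ K * (1 / m.factorial))
    (w : ℝ) :
    HasDerivAt (fun w => ∑' m, a m * w ^ m) (∑' m : ℕ, (m + 1) * a (m + 1) * w ^ m) w := by
  have hsum : ∀ y : ℝ, Summable fun m => a m * y ^ m := by
    intro y
    refine Summable.of_norm_bounded
      (g := fun m : ℕ => K * (|y| ^ m / m.factorial)) ((Real.summable_pow_div_factorial _).mul_left _)
      fun m => ?_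
    rw [Real.norm_eq_abs, abs_mul, abs_pow]
    calc |a m| * |y| ^ m ≤ K * (1 / m.factorial) * |y| ^ m := by gcongr; exact ha m
      _ = _ := by ring
  set R := |w| + 1 with hR
  have hR0 : 0 ≤ R := by positivity
  have hbound : ∀ m : ℕ, |a (m + 1) * ((m + 1 : ℕ) * R ^ m)| ≤ K * (R ^ m / m.factorial) := by
    intro m
    have hf : (0 : ℝ) < m.factorial := by exact_mod_cast m.factorial_pos
    rw [abs_mul, abs_of_nonneg (by positivity : (0 : ℝ) ≤ ((m + 1 : ℕ) : ℝ) * R ^ m)]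
    calc |a (m + 1)| * (((m + 1 : ℕ) : ℝ) * R ^ m)
        ≤ K * (1 / (m + 1).factorial) * (((m + 1 : ℕ) : ℝ) * R ^ m) := by gcongr; exact ha _
      _ = _ := by
        rw [Nat.factorial_succ]
        push_cast
        field_simp
  have hu : Summable fun m : ℕ => |a m * (m * R ^ (m - 1))| := by
    rw [← summable_nat_add_iff 1]
    exact Summable.of_nonneg_of_le (fun _ => abs_nonneg _)
      (fun m => by simpa using hbound m) ((Real.summable_pow_div_factorial _).mul_left _)
  have hder := hasDerivAt_tsum_of_isPreconnected (g := fun m w => a m * w ^ m)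
    (g' := fun m w => a m * (m * w ^ (m - 1))) (t := Metric.ball 0 R) (y₀ := w) (y := w) hu
    Metric.isOpen_ball (convex_ball _ _).isPreconnected
    (fun m y _ => (hasDerivAt_pow m y).const_mul (a m))
    (fun m y hy => by
      rw [Real.norm_eq_abs, abs_mul, abs_mul (a m)]
      have hy' : |y| < R := by simpa using hy
      have : |(m : ℝ) * y ^ (m - 1)| ≤ |(m : ℝ) * R ^ (m - 1)| := by
        rw [abs_mul, abs_mul, abs_pow, abs_pow, abs_of_nonneg hR0]
        gcongr
      gcongr)
    (by simp [hR]) (hsum w) (by simp [hR])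
  have hs : Summable fun m : ℕ => a m * (m * w ^ (m - 1)) := by
    refine Summable.of_norm_bounded hu fun m => ?_
    rw [Real.norm_eq_abs, abs_mul, abs_mul (a m), abs_mul, abs_mul (m : ℝ), abs_pow, abs_pow,
      abs_of_nonneg hR0]
    gcongr
    linarith
  refine hder.congr_deriv ?_
  rw [hs.tsum_eq_zero_add]
  simp only [CharP.cast_eq_zero, zero_mul, mul_zero, zero_add]
  refine tsum_congr fun m => ?_
  simp only [Nat.add_sub_cancel]
  push_cast
  ring

lemma summable_besselEntire {μ : ℝ} (hμ : -(1/2 : ℝ) < μ) (w : ℝ) :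
    Summable fun m : ℕ =>
      ((-1 : ℝ) ^ m / ((m.factorial : ℝ) * Real.Gamma ((m : ℝ) + μ + 1))) * w ^ m := by
  refine Summable.of_norm_bounded
    (g := fun m : ℕ => 2 / Real.Gamma (μ + 1) * (|w| ^ m / m.factorial))
    ((Real.summable_pow_div_factorial _).mul_left _) fun m => ?_
  rw [Real.norm_eq_abs, abs_mul, abs_pow]
  refine (mul_le_mul_of_nonneg_right (abs_besselEntire_coeff_le hμ m) (by positivity)).trans_eq ?_
  ring

lemma hasDerivAt_besselEntire {μ : ℝ} (hμ : -(1/2 : ℝ) < μ) (w : ℝ) :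
    HasDerivAt (besselEntire μ) (-besselEntire (μ + 1) w) w := by
  have h := hasDerivAt_tsum_mul_pow (abs_besselEntire_coeff_le hμ) w
  refine h.congr_deriv ?_
  rw [besselEntire, ← tsum_neg]
  refine tsum_congr fun m => ?_
  have hm : (0 : ℝ) ≤ m := m.cast_nonneg
  have hG : Real.Gamma ((m : ℝ) + (μ + 1) + 1) ≠ 0 :=
    (Real.Gamma_pos_of_pos (by linarith)).ne'
  have hf : (m.factorial : ℝ) ≠ 0 := by exact_mod_cast m.factorial_ne_zero
  have hm1 : (m : ℝ) + 1 ≠ 0 := by positivity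
  rw [Nat.factorial_succ, show ((m + 1 : ℕ) : ℝ) + μ + 1 = (m : ℝ) + (μ + 1) + 1 by
    push_cast; ring]
  push_cast
  field_simp
  ring

/-- The three-term recurrence in the order. -/
lemma besselEntire_recurrence {μ : ℝ} (hμ : -(1/2 : ℝ) < μ) (w : ℝ) :
    w * besselEntire (μ + 2) w = (μ + 1) * besselEntire (μ + 1) w - besselEntire μ w := by
  have h1 := summable_besselEntire (μ := μ + 1) (by linarith) w
  have h0 := summable_besselEntire hμ w
  simp only [besselEntire]
  rw [← tsum_mul_left, ← tsum_mul_left, ← (h1.mul_left _).tsum_sub h0,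
    ((h1.mul_left _).sub h0).tsum_eq_zero_add]
  have hz : (μ + 1) * ((-1 : ℝ) ^ 0 / (((0 : ℕ).factorial : ℝ) *
      Real.Gamma (((0 : ℕ) : ℝ) + (μ + 1) + 1)) * w ^ 0) - (-1 : ℝ) ^ 0 /
      (((0 : ℕ).factorial : ℝ) * Real.Gamma (((0 : ℕ) : ℝ) + μ + 1)) * w ^ 0 = 0 := by
    have hG : Real.Gamma (μ + 1) ≠ 0 := (Real.Gamma_pos_of_pos (by linarith)).ne'
    have hμ1 : μ + 1 ≠ 0 := by linarith
    simp only [Nat.cast_zero, zero_add, Nat.factorial_zero, Nat.cast_one, pow_zero, one_mul,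
      mul_one, Real.Gamma_add_one hμ1]
    field_simp
    simp
  rw [hz, zero_add]
  refine tsum_congr fun m => ?_
  have hm : (0 : ℝ) ≤ m := m.cast_nonneg
  have hp : (m : ℝ) + μ + 2 ≠ 0 := by linarith
  have hG : Real.Gamma ((m : ℝ) + μ + 2) ≠ 0 := (Real.Gamma_pos_of_pos (by linarith)).ne'
  have hf : (m.factorial : ℝ) ≠ 0 := by exact_mod_cast m.factorial_ne_zero
  have hm1 : (m : ℝ) + 1 ≠ 0 := by positivity
  rw [Nat.factorial_succ,
    show ((m + 1 : ℕ) : ℝ) + (μ + 1) + 1 = (m : ℝ) + μ + 2 + 1 by push_cast; ring,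
    show ((m + 1 : ℕ) : ℝ) + μ + 1 = (m : ℝ) + μ + 2 by push_cast; ring,
    show (m : ℝ) + (μ + 2) + 1 = (m : ℝ) + μ + 2 + 1 by ring,
    Real.Gamma_add_one hp]
  push_cast
  field_simp
  ring

lemma besselJ_eq {μ x : ℝ} (hx : 0 < x) :
    besselJ μ x = (x / 2) ^ μ * besselEntire μ (x ^ 2 / 4) := by
  rw [besselJ, besselEntire, ← tsum_mul_left]
  refine tsum_congr fun m => ?_
  have h2 : (0 : ℝ) < x / 2 := by positivity
  rw [Real.rpow_add h2, Real.rpow_mul h2.le, Real.rpow_natCast, Real.rpow_two]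
  ring_nf

/-- `2^ν √z J_ν(z)` for `z > 0`. -/
noncomputable def besselU (ν z : ℝ) : ℝ := z ^ (ν + 1/2) * besselEntire ν (z ^ 2 / 4)

/-- The derivative of `besselU`. -/
noncomputable def besselV (ν z : ℝ) : ℝ :=
  (ν + 1/2) * z ^ (ν - 1/2) * besselEntire ν (z ^ 2 / 4)
    - z ^ (ν + 3/2) / 2 * besselEntire (ν + 1) (z ^ 2 / 4)

lemma hasDerivAt_besselEntire_sq {μ : ℝ} (hμ : -(1/2 : ℝ) < μ) (z : ℝ) :
    HasDerivAt (fun z => besselEntire μ (z ^ 2 / 4))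
      (-besselEntire (μ + 1) (z ^ 2 / 4) * (z / 2)) z := by
  have h : HasDerivAt (fun z : ℝ => z ^ 2 / 4) (z / 2) z := by
    refine ((hasDerivAt_pow 2 z).div_const 4).congr_deriv ?_
    push_cast
    ring
  exact (hasDerivAt_besselEntire hμ _).comp z h

lemma hasDerivAt_besselU {ν z : ℝ} (hν : -(1/2 : ℝ) < ν) (hz : 0 < z) :
    HasDerivAt (besselU ν) (besselV ν z) z := by
  refine ((Real.hasDerivAt_rpow_const (p := ν + 1/2) (Or.inl hz.ne')).mul
    (hasDerivAt_besselEntire_sq hν z)).congr_deriv ?_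
  rw [besselV, show ν + 3/2 = ν + 1/2 + 1 by ring, Real.rpow_add_one hz.ne',
    show ν + 1/2 - 1 = ν - 1/2 by ring]
  ring

lemma hasDerivAt_besselV {ν z : ℝ} (hν : -(1/2 : ℝ) < ν) (hz : 0 < z) :
    HasDerivAt (besselV ν) (((ν ^ 2 - 1/4) / z ^ 2 - 1) * besselU ν z) z := by
  have h1 := ((Real.hasDerivAt_rpow_const (p := ν - 1/2) (Or.inl hz.ne')).const_mul
    (ν + 1/2)).mul (hasDerivAt_besselEntire_sq hν z)
  have h2 := ((Real.hasDerivAt_rpow_const (p := ν + 3/2) (Or.inl hz.ne')).div_const 2).mul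
    (hasDerivAt_besselEntire_sq (μ := ν + 1) (by linarith) z)
  refine (h1.sub h2).congr_deriv ?_
  have hrec := besselEntire_recurrence hν (z ^ 2 / 4)
  rw [show ν + 1 + 1 = ν + 2 by ring, besselU,
    show ν + 3/2 - 1 = ν - 3/2 + 1 + 1 by ring, show ν + 3/2 = ν - 3/2 + 1 + 1 + 1 by ring,
    show ν - 1/2 - 1 = ν - 3/2 by ring, show ν - 1/2 = ν - 3/2 + 1 by ring,
    show ν + 1/2 = ν - 3/2 + 1 + 1 by ring]
  simp only [Real.rpow_add_one hz.ne']
  field_simp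
  linear_combination (16 * z ^ 2) * hrec

section Energy

variable {u v : ℝ → ℝ} {c : ℝ}

lemma hasDerivAt_energy_mul_exp (hu : ∀ z, 0 < z → HasDerivAt u (v z) z)
    (hv : ∀ z, 0 < z → HasDerivAt v ((c / z ^ 2 - 1) * u z) z) (b : ℝ) {z : ℝ} (hz : 0 < z) :
    HasDerivAt (fun z => (u z ^ 2 + v z ^ 2) * Real.exp (b / z))
      ((2 * c * u z * v z - b * (u z ^ 2 + v z ^ 2)) / z ^ 2 * Real.exp (b / z)) z := by
  have he : HasDerivAt (fun z => b / z) (-b / z ^ 2) z := by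
    refine ((hasDerivAt_inv hz.ne').const_mul b).congr_deriv ?_
    ring
  refine ((((hu z hz).pow 2).add ((hv z hz).pow 2)).mul he.exp).congr_deriv ?_
  simp only [Pi.add_apply, Pi.pow_apply]
  field_simp
  ring

lemma abs_two_mul_mul_le (c x y : ℝ) : |2 * c * x * y| ≤ |c| * (x ^ 2 + y ^ 2) := by
  rw [show 2 * c * x * y = c * (2 * x * y) by ring, abs_mul]
  refine mul_le_mul_of_nonneg_left (abs_le.2 ⟨?_, ?_⟩) (abs_nonneg c)
  · nlinarith [sq_nonneg (x + y)]
  · nlinarith [sq_nonneg (x - y)]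

lemma energy_le (hu : ∀ z, 0 < z → HasDerivAt u (v z) z)
    (hv : ∀ z, 0 < z → HasDerivAt v ((c / z ^ 2 - 1) * u z) z) {z₀ z : ℝ} (hz₀ : 0 < z₀)
    (hz : z₀ ≤ z) :
    u z ^ 2 + v z ^ 2 ≤ (u z₀ ^ 2 + v z₀ ^ 2) * Real.exp (|c| / z₀) := by
  have hanti : AntitoneOn (fun z => (u z ^ 2 + v z ^ 2) * Real.exp (|c| / z)) (Ioi 0) := by
    refine antitoneOn_of_hasDerivWithinAt_nonpos (convex_Ioi 0)
      (fun x hx => (hasDerivAt_energy_mul_exp hu hv _ hx).continuousAt.continuousWithinAt)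
      (fun x hx => (hasDerivAt_energy_mul_exp hu hv _
        (interior_subset hx)).hasDerivWithinAt) fun x _ => ?_
    have := (abs_le.1 (abs_two_mul_mul_le c (u x) (v x))).2
    exact mul_nonpos_of_nonpos_of_nonneg
      (div_nonpos_of_nonpos_of_nonneg (by linarith) (by positivity)) (Real.exp_pos _).le
  refine le_trans ?_ (hanti (mem_Ioi.2 hz₀) (mem_Ioi.2 (hz₀.trans_le hz)) hz)
  have hz' : 0 < z := hz₀.trans_le hz
  exact le_mul_of_one_le_right (by positivity) (Real.one_le_exp (by positivity))

lemma le_energy (hu : ∀ z, 0 < z → HasDerivAt u (v z) z)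
    (hv : ∀ z, 0 < z → HasDerivAt v ((c / z ^ 2 - 1) * u z) z) {z₀ z : ℝ} (hz₀ : 0 < z₀)
    (hz : z₀ ≤ z) :
    (u z₀ ^ 2 + v z₀ ^ 2) * Real.exp (-|c| / z₀) ≤ u z ^ 2 + v z ^ 2 := by
  have hmono : MonotoneOn (fun z => (u z ^ 2 + v z ^ 2) * Real.exp (-|c| / z)) (Ioi 0) := by
    refine monotoneOn_of_hasDerivWithinAt_nonneg (convex_Ioi 0)
      (fun x hx => (hasDerivAt_energy_mul_exp hu hv _ hx).continuousAt.continuousWithinAt)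
      (fun x hx => (hasDerivAt_energy_mul_exp hu hv _
        (interior_subset hx)).hasDerivWithinAt) fun x _ => ?_
    have := (abs_le.1 (abs_two_mul_mul_le c (u x) (v x))).1
    exact mul_nonneg (div_nonneg (by linarith) (by positivity)) (Real.exp_pos _).le
  refine (hmono (mem_Ioi.2 hz₀) (mem_Ioi.2 (hz₀.trans_le hz)) hz).trans ?_
  have hz' : 0 < z := hz₀.trans_le hz
  refine mul_le_of_le_one_right (by positivity) (Real.exp_le_one_iff.2 ?_)
  exact div_nonpos_of_nonpos_of_nonneg (neg_nonpos.2 (abs_nonneg c)) hz'.le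

/-- Two-sided energy bounds separate the zeros of `u`. -/
lemma sqrt_le_sub_of_zeros {k K z₀ a b : ℝ} (hK : 0 < K)
    (hu : ∀ z, z₀ ≤ z → HasDerivAt u (v z) z)
    (hlow : ∀ z, z₀ ≤ z → k ≤ u z ^ 2 + v z ^ 2) (hupp : ∀ z, z₀ ≤ z → u z ^ 2 + v z ^ 2 ≤ K)
    (ha : z₀ ≤ a) (hab : a < b) (hua : u a = 0) (hub : u b = 0) :
    √(k / K) ≤ b - a := by
  have hcont : ContinuousOn u (Icc a b) := fun x hx =>
    (hu x (ha.trans hx.1)).continuousAt.continuousWithinAt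
  obtain ⟨ξ, hξ, hvξ⟩ := exists_hasDerivAt_eq_zero hab hcont (hua.trans hub.symm)
    fun x hx => hu x (ha.trans hx.1.le)
  obtain ⟨η, hη, hvη⟩ := exists_hasDerivAt_eq_slope u v hξ.1
    (hcont.mono (Icc_subset_Icc_right hξ.2.le)) fun x hx => hu x (ha.trans hx.1.le)
  rw [hua, sub_zero, eq_div_iff (sub_pos.2 hξ.1).ne'] at hvη
  have h1 := hlow ξ (ha.trans hξ.1.le)
  have h2 := hupp η (ha.trans hη.1.le)
  rw [hvξ, ← hvη] at h1
  have hgap : 0 ≤ b - a := by linarith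
  refine Real.sqrt_le_iff.2 ⟨hgap, (div_le_iff₀ hK).2 ?_⟩
  have h3 : (ξ - a) ^ 2 ≤ (b - a) ^ 2 := by
    have := hξ.1
    have := hξ.2
    gcongr
  have h4 : v η ^ 2 ≤ K := by nlinarith [sq_nonneg (u η)]
  calc k ≤ (ξ - a) ^ 2 * v η ^ 2 := by linarith
    _ ≤ (b - a) ^ 2 * K := by gcongr

end Energy

lemma summable_exp_neg_of_gap {Λ : ℕ → ℝ} {δ : ℝ} (hδ : 0 < δ) (h0 : 0 ≤ Λ 0)
    (hgap : ∀ n, δ ≤ Λ (n + 1) - Λ n) : Summable fun n => Real.exp (-Λ n) := by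
  have hlin : ∀ n : ℕ, n * δ ≤ Λ n := by
    intro n
    induction n with
    | zero => simpa using h0
    | succ n ih =>
      have := hgap n
      push_cast
      linarith
  refine Summable.of_nonneg_of_le (fun _ => (Real.exp_pos _).le) (fun n => ?_)
    (Real.summable_exp_nat_mul_iff.2 (neg_lt_zero.2 hδ))
  have := hlin n
  exact Real.exp_le_exp.2 (by linarith)

lemma exists_abs_besselU_le_of_le_one {ν : ℝ} (hν : -(1/2 : ℝ) < ν) :
    ∃ M, ∀ z, 0 < z → z ≤ 1 → |besselU ν z| ≤ M := by
  have hc : Continuous fun z => besselEntire ν (z ^ 2 / 4) :=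
    continuous_iff_continuousAt.2 fun z => (hasDerivAt_besselEntire_sq hν z).continuousAt
  obtain ⟨M, hM⟩ := isCompact_Icc.exists_bound_of_continuousOn (s := Icc (0 : ℝ) 1) hc.continuousOn
  refine ⟨M, fun z hz hz1 => ?_⟩
  rw [besselU, abs_mul, abs_of_pos (Real.rpow_pos_of_pos hz _)]
  exact (mul_le_of_le_one_left (abs_nonneg _)
    (Real.rpow_le_one hz.le hz1 (by linarith))).trans (hM z ⟨hz.le, hz1⟩)

lemma sqrt_mul_besselJ {ν z : ℝ} (hz : 0 < z) :
    √z * besselJ ν z = 2 ^ (-ν) * besselU ν z := by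
  rw [besselJ_eq hz, besselU, Real.rpow_add hz, ← Real.sqrt_eq_rpow,
    Real.div_rpow hz.le zero_le_two, Real.rpow_neg zero_le_two]
  ring

lemma besselU_eq_zero_iff {ν z : ℝ} (hz : 0 < z) : besselU ν z = 0 ↔ besselJ ν z = 0 := by
  have h := sqrt_mul_besselJ (ν := ν) hz
  have h2 : (2 : ℝ) ^ (-ν) ≠ 0 := (Real.rpow_pos_of_pos two_pos _).ne'
  have hs : √z ≠ 0 := (Real.sqrt_pos.2 hz).ne'
  constructor <;> intro h0
  · simpa [h0, hs] using h
  · simpa [h0, h2] using h.symm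

lemma sqrt_mul_besselJ_add_one_of_zero {ν z : ℝ} (hz : 0 < z) (h0 : besselU ν z = 0) :
    √z * besselJ (ν + 1) z = -(2 ^ (-ν) * besselV ν z) := by
  have hE : besselEntire ν (z ^ 2 / 4) = 0 :=
    (mul_eq_zero.1 h0).resolve_left (Real.rpow_pos_of_pos hz _).ne'
  rw [besselJ_eq hz, besselV, hE, show ν + 3/2 = ν + 1 + 1/2 by ring, Real.rpow_add hz,
    ← Real.sqrt_eq_rpow, Real.div_rpow hz.le zero_le_two, Real.rpow_add_one two_ne_zero,
    Real.rpow_neg zero_le_two]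
  field_simp
  ring

lemma abs_rpow_mul_phiFB {ν x : ℝ} {Λ : ℕ → ℝ} {n : ℕ} (hΛ : 0 < Λ n)
    (h0 : besselU ν (Λ n) = 0) (hx : 0 < x) :
    |x ^ (ν + 1/2) * phiFB ν Λ n x| = √2 * |besselU ν (Λ n * x)| / (√(Λ n) * |besselV ν (Λ n)|) := by
  have hs : 0 < √(Λ n) := Real.sqrt_pos.2 hΛ
  have h2 : (0 : ℝ) < 2 ^ (-ν) := Real.rpow_pos_of_pos two_pos _
  have hden : |Λ n * besselJ (ν + 1) (Λ n)| = √(Λ n) * (2 ^ (-ν) * |besselV ν (Λ n)|) := by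
    nth_rewrite 1 [← Real.mul_self_sqrt hΛ.le]
    rw [mul_assoc, sqrt_mul_besselJ_add_one_of_zero hΛ h0, abs_mul, abs_neg, abs_mul,
      abs_of_pos hs, abs_of_pos h2]
  have hnum : x ^ (ν + 1/2) * phiFB ν Λ n x =
      √2 / |Λ n * besselJ (ν + 1) (Λ n)| * (2 ^ (-ν) * besselU ν (Λ n * x)) := by
    rw [← sqrt_mul_besselJ (mul_pos hΛ hx), phiFB, Real.rpow_add hx, Real.rpow_neg hx.le,
      ← Real.sqrt_eq_rpow, Real.sqrt_mul hΛ.le]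
    have := (Real.rpow_pos_of_pos hx ν).ne'
    field_simp
  rw [hnum, hden, abs_mul, abs_mul, abs_of_pos h2, abs_of_nonneg (by positivity)]
  field_simp

/-- The kernel `P_t(x,y)` is bounded uniformly in `t > 1` and `x, y ∈ (0,1)`. -/
lemma exists_abs_pKerL_le {ν : ℝ} (hν : -(1/2 : ℝ) < ν) {Λ : ℕ → ℝ}
    (hΛ : IsPositiveZerosOfBesselJ ν Λ) :
    ∃ C : ℝ, 0 < C ∧ ∀ t, 1 < t → ∀ x ∈ Ioo (0 : ℝ) 1, ∀ y ∈ Ioo (0 : ℝ) 1,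
      |pKerL ν Λ t x y| ≤ C := by
  obtain ⟨hmono, hpos, hzero, hall⟩ := hΛ
  have hU0 : ∀ n, besselU ν (Λ n) = 0 := fun n => (besselU_eq_zero_iff (hpos n)).2 (hzero n)
  have hu : ∀ z, 0 < z → HasDerivAt (besselU ν) (besselV ν z) z := fun z => hasDerivAt_besselU hν
  have hv := fun z (hz : 0 < z) => hasDerivAt_besselV hν hz
  set c := ν ^ 2 - 1/4
  obtain ⟨z₀, hz₀, hz₀1, hz₀Λ⟩ : ∃ z₀, 0 < z₀ ∧ z₀ ≤ 1 ∧ z₀ < Λ 0 :=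
    ⟨min 1 (Λ 0 / 2), lt_min one_pos (half_pos (hpos 0)), min_le_left _ _,
      (min_le_right _ _).trans_lt (half_lt_self (hpos 0))⟩
  have hΛ0 : ∀ n, Λ 0 ≤ Λ n := fun n => hmono.monotone n.zero_le
  have hUz₀ : besselU ν z₀ ≠ 0 := by
    intro h
    obtain ⟨n, hn⟩ := hall z₀ hz₀ ((besselU_eq_zero_iff hz₀).1 h)
    have := hΛ0 n
    linarith
  have hE : 0 < besselU ν z₀ ^ 2 + besselV ν z₀ ^ 2 := by positivity
  set k := (besselU ν z₀ ^ 2 + besselV ν z₀ ^ 2) * Real.exp (-|c| / z₀)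
  set K := (besselU ν z₀ ^ 2 + besselV ν z₀ ^ 2) * Real.exp (|c| / z₀)
  have hk : 0 < k := by positivity
  have hK : 0 < K := by positivity
  have hlow : ∀ z, z₀ ≤ z → k ≤ besselU ν z ^ 2 + besselV ν z ^ 2 := fun z => le_energy hu hv hz₀
  have hupp : ∀ z, z₀ ≤ z → besselU ν z ^ 2 + besselV ν z ^ 2 ≤ K := fun z => energy_le hu hv hz₀
  have hz₀n : ∀ n, z₀ ≤ Λ n := fun n => hz₀Λ.le.trans (hΛ0 n)
  have hsum : Summable fun n => Real.exp (-Λ n) :=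
    summable_exp_neg_of_gap (Real.sqrt_pos.2 (div_pos hk hK)) (hpos 0).le fun n =>
      sqrt_le_sub_of_zeros hK (fun z hz => hu z (hz₀.trans_le hz)) hlow hupp (hz₀n n)
        (hmono n.lt_succ_self) (hU0 n) (hU0 (n + 1))
  obtain ⟨M₁, hM₁⟩ := exists_abs_besselU_le_of_le_one hν
  obtain ⟨M, hM⟩ : ∃ M, ∀ z, 0 < z → |besselU ν z| ≤ M := by
    refine ⟨max M₁ √K, fun z hz => ?_⟩
    rcases le_total z 1 with h | h
    · exact (hM₁ z hz h).trans (le_max_left _ _)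
    · refine (Real.abs_le_sqrt ?_).trans (le_max_right _ _)
      nlinarith [hupp z (hz₀1.trans h), sq_nonneg (besselV ν z)]
  have hM0 : 0 ≤ M := (abs_nonneg _).trans (hM 1 one_pos)
  have hV : ∀ n, √k ≤ |besselV ν (Λ n)| := fun n => by
    refine Real.sqrt_le_iff.2 ⟨abs_nonneg _, ?_⟩
    have := hlow _ (hz₀n n)
    rw [hU0 n] at this
    rw [sq_abs]
    linarith
  set B := √2 * M / (√(Λ 0) * √k)
  have hsk : 0 < √k := Real.sqrt_pos.2 hk
  have hs0 : 0 < √(Λ 0) := Real.sqrt_pos.2 (hpos 0)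
  have hB : 0 ≤ B := by positivity
  have hphi : ∀ n, ∀ x ∈ Ioo (0 : ℝ) 1, |x ^ (ν + 1/2) * phiFB ν Λ n x| ≤ B := by
    intro n x hx
    rw [abs_rpow_mul_phiFB (hpos n) (hU0 n) hx.1]
    have h1 := hM _ (mul_pos (hpos n) hx.1)
    have h2 := hV n
    have h3 := Real.sqrt_le_sqrt (hΛ0 n)
    simp only [B]
    gcongr
  refine ⟨B * B * (∑' n, Real.exp (-Λ n)) + 1, ?_, fun t ht x hx y hy => ?_⟩
  · have : 0 ≤ ∑' n, Real.exp (-Λ n) := tsum_nonneg fun n => (Real.exp_pos _).le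
    positivity
  rw [pKerL, pKer, ← tsum_mul_left, Real.mul_rpow hx.1.le hy.1.le]
  refine le_trans ?_ (lt_add_one _).le
  rw [← Real.norm_eq_abs]
  refine tsum_of_norm_bounded (hsum.hasSum.mul_left (B * B)) fun n => ?_
  rw [Real.norm_eq_abs, show x ^ (ν + 1/2) * y ^ (ν + 1/2) *
      (Real.exp (-t * Λ n) * phiFB ν Λ n x * phiFB ν Λ n y) =
    (x ^ (ν + 1/2) * phiFB ν Λ n x) * (y ^ (ν + 1/2) * phiFB ν Λ n y) * Real.exp (-t * Λ n) by ring,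
    abs_mul, abs_mul, Real.abs_exp]
  have hexp : Real.exp (-t * Λ n) ≤ Real.exp (-Λ n) :=
    Real.exp_le_exp.2 (by nlinarith [hpos n])
  gcongr
  exacts [hphi n x hx, hphi n y hy]

/-- The maximal operator `M^∞ g = sup_{t>1} |P_t g|` is bounded on `L¹(0,1)` (Lemma 5.1). -/
theorem maximal_large_time_L1_bounded_leb (ν : ℝ) (hν : -(1/2 : ℝ) < ν)
    (Λ : ℕ → ℝ) (hΛ : IsPositiveZerosOfBesselJ ν Λ) :
    ∃ C : ℝ, 0 < C ∧
      ∀ g : ℝ → ℝ, IntegrableOn g (Ioo 0 1) →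
        ∫⁻ x in Ioo (0:ℝ) 1, (⨆ t : {t : ℝ // 1 < t},
            (‖∫ y in Ioo (0:ℝ) 1, pKerL ν Λ t.1 x y * g y‖₊ : ℝ≥0∞))
          ≤ ENNReal.ofReal C * ∫⁻ y in Ioo (0:ℝ) 1, ‖g y‖₊ := by
  obtain ⟨C, hC, hbound⟩ := exists_abs_pKerL_le hν hΛ
  refine ⟨C, hC, fun g _ => ?_⟩
  calc ∫⁻ x in Ioo (0:ℝ) 1, (⨆ t : {t : ℝ // 1 < t},
            (‖∫ y in Ioo (0:ℝ) 1, pKerL ν Λ t.1 x y * g y‖₊ : ℝ≥0∞))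
      ≤ ∫⁻ _ in Ioo (0:ℝ) 1, (ENNReal.ofReal C * ∫⁻ y in Ioo (0:ℝ) 1, ‖g y‖₊) := by
        refine setLIntegral_mono' measurableSet_Ioo fun x hx => iSup_le fun t => ?_
        refine (enorm_integral_le_lintegral_enorm _).trans ?_
        rw [← lintegral_const_mul' _ _ ENNReal.ofReal_ne_top]
        refine setLIntegral_mono' measurableSet_Ioo fun y hy => ?_
        rw [enorm_mul]
        refine mul_le_mul_left ?_ _
        rw [← ofReal_norm, Real.norm_eq_abs]
        exact ENNReal.ofReal_le_ofReal (hbound t.1 t.2 x hx y hy)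
    _ = ENNReal.ofReal C * ∫⁻ y in Ioo (0:ℝ) 1, ‖g y‖₊ := by
        simp
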